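/- Let μ be a probability measure on ℝ² with continuous marginal cumulative distribution functions, whose topological support is the boundary of the square with vertices (0,1), (1,0), (2,1), (1,2) (i.e., the set {(x,y) ∈ ℝ² : |x−1| + |y−1| = 1}), and which is symmetric about the center (1,1) (i.e., μ is invariant under the map (x,y) ↦ (2−x, 2−y)). Then d_τ(x,y) := F(x,y) − (F_X(x)+F_Y(y))/2 equals −1/4 at every point (x,y) of the support; in particular, d_τ is constant on the support even though the support contains the four vertices of infinitely many axis-parallel rectangles. -/

import Mathlib

open MeasureTheory Set

/-- A probability measure on `ℝ` whose distribution function is continuous has no atoms. -/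
lemma nullSingletonClass_of_continuous_real_Iic (ν : Measure ℝ) [IsProbabilityMeasure ν]
    (h : Continuous fun x => ν.real (Iic x)) : NullSingletonClass ν := by
  refine ⟨fun a => ?_⟩
  have hcdf : (ProbabilityTheory.cdf ν : ℝ → ℝ) = fun x => ν.real (Iic x) :=
    funext (ProbabilityTheory.cdf_eq_real ν)
  have hcont : ContinuousAt (ProbabilityTheory.cdf ν) a := hcdf ▸ h.continuousAt
  rw [← ProbabilityTheory.measure_cdf ν, StieltjesFunction.measure_singleton,
    hcont.continuousWithinAt.leftLim_eq, sub_self, ENNReal.ofReal_zero]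

section SymmetricAboutPoint

variable {ν : Measure ℝ} [IsProbabilityMeasure ν] [NullSingletonClass ν] {c : ℝ}

/-- The distribution function of an atomless measure symmetric about `c` is symmetric. -/
lemma real_Iic_reflect (hsym : ν.map (fun x => 2 * c - x) = ν) (x : ℝ) :
    ν.real (Iic (2 * c - x)) = 1 - ν.real (Iic x) := by
  have hpre : (fun y => 2 * c - y) ⁻¹' Iic (2 * c - x) = Ici x := by
    ext y; simp
  have hmap : ν.real (Iic (2 * c - x)) = ν.real (Ici x) := by
    conv_lhs => rw [← hsym]
    rw [map_measureReal_apply (by fun_prop) measurableSet_Iic, hpre]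
  rw [hmap, ← measureReal_congr (Ioi_ae_eq_Ici (μ := ν)), ← compl_Iic,
    probReal_compl_eq_one_sub measurableSet_Iic]

/-- The mass of a centred interval under an atomless measure symmetric about `c`. -/
lemma real_Ioc_centred (hsym : ν.map (fun x => 2 * c - x) = ν) {t : ℝ} (ht : 0 ≤ t) :
    ν.real (Ioc (c - t) (c + t)) = 1 - 2 * ν.real (Iic (c - t)) := by
  have h := real_Iic_reflect hsym (c - t)
  rw [show 2 * c - (c - t) = c + t by ring] at h
  rw [← Iic_sdiff_Iic, measureReal_sdiff (Iic_subset_Iic.2 (by linarith)) measurableSet_Iic, h]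
  ring

end SymmetricAboutPoint

/-- For a centrally symmetric measure carried by the `ℓ¹` unit circle around `(1, 1)`, the marginal
distribution functions add up to `1 / 2` along the lower left side. -/
lemma real_Iic_fst_add_real_Iic_snd {μ : Measure (ℝ × ℝ)} [IsProbabilityMeasure μ]
    [NullSingletonClass (μ.map Prod.fst)] [NullSingletonClass (μ.map Prod.snd)]
    (hX : (μ.map Prod.fst).map (fun x => 2 * 1 - x) = μ.map Prod.fst)
    (hY : (μ.map Prod.snd).map (fun y => 2 * 1 - y) = μ.map Prod.snd)
    (hS : ∀ᵐ p ∂μ, |p.1 - 1| + |p.2 - 1| = 1) {x : ℝ} (h0 : 0 ≤ x) (h1 : x ≤ 1) :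
    (μ.map Prod.fst).real (Iic x) + (μ.map Prod.snd).real (Iic (1 - x)) = 1 / 2 := by
  have : IsProbabilityMeasure (μ.map Prod.fst) :=
    Measure.isProbabilityMeasure_map measurable_fst.aemeasurable
  have : IsProbabilityMeasure (μ.map Prod.snd) :=
    Measure.isProbabilityMeasure_map measurable_snd.aemeasurable
  have hfst := real_Ioc_centred hX (sub_nonneg.2 h1)
  have hsnd := real_Ioc_centred hY h0
  rw [show (1 : ℝ) - (1 - x) = x by ring] at hfst
  rw [measureReal_congr Ioc_ae_eq_Icc, map_measureReal_apply measurable_fst measurableSet_Icc]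
    at hfst
  rw [← measureReal_congr Ioo_ae_eq_Ioc, map_measureReal_apply measurable_snd measurableSet_Ioo]
    at hsnd
  have hcompl : (Prod.fst ⁻¹' Icc x (1 + (1 - x)) : Set (ℝ × ℝ))
      =ᵐ[μ] ((Prod.snd ⁻¹' Ioo (1 - x) (1 + x))ᶜ : Set (ℝ × ℝ)) := by
    filter_upwards [hS] with p hp
    have hiff : p ∈ (Prod.fst ⁻¹' Icc x (1 + (1 - x)) : Set (ℝ × ℝ)) ↔
        p ∈ (Prod.snd ⁻¹' Ioo (1 - x) (1 + x) : Set (ℝ × ℝ))ᶜ := by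
      have hl : p.1 ∈ Icc x (1 + (1 - x)) ↔ |p.1 - 1| ≤ 1 - x := by
        rw [abs_le, mem_Icc]; constructor <;> rintro ⟨_, _⟩ <;> constructor <;> linarith
      have hr : p.2 ∈ Ioo (1 - x) (1 + x) ↔ |p.2 - 1| < x := by
        rw [abs_lt, mem_Ioo]; constructor <;> rintro ⟨_, _⟩ <;> constructor <;> linarith
      rw [mem_compl_iff, mem_preimage, mem_preimage, hl, hr, not_lt]
      constructor <;> intro _ <;> linarith
    exact propext hiff
  rw [measureReal_congr hcompl,
    probReal_compl_eq_one_sub (measurable_snd measurableSet_Ioo), hsnd] at hfst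
  linarith

theorem stmt_18
    (μ : Measure (ℝ × ℝ)) [IsProbabilityMeasure μ]
    (F : ℝ → ℝ → ℝ) (FX FY : ℝ → ℝ) (dτ : ℝ × ℝ → ℝ)
    (hF : ∀ x y, F x y = (μ (Iic x ×ˢ Iic y)).toReal)
    (hFX : ∀ x, FX x = (μ (Iic x ×ˢ (univ : Set ℝ))).toReal)
    (hFY : ∀ y, FY y = (μ ((univ : Set ℝ) ×ˢ Iic y)).toReal)
    (hFXcont : Continuous FX) (hFYcont : Continuous FY)
    (hdτ : ∀ p : ℝ × ℝ, dτ p = F p.1 p.2 - (FX p.1 + FY p.2) / 2)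
    (S : Set (ℝ × ℝ))
    (hS : S = {p : ℝ × ℝ | |p.1 - 1| + |p.2 - 1| = 1})
    (hSfull : μ Sᶜ = 0)
    (hSmin : ∀ T : Set (ℝ × ℝ), IsClosed T → μ Tᶜ = 0 → S ⊆ T)
    (hsym : Measure.map (fun p : ℝ × ℝ => (2 - p.1, 2 - p.2)) μ = μ) :
    ∀ p ∈ S, dτ p = -(1 / 4) := by
  subst hS
  have hae : ∀ᵐ p ∂μ, |p.1 - 1| + |p.2 - 1| = 1 := hSfull
  have : IsProbabilityMeasure (μ.map Prod.fst) :=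
    Measure.isProbabilityMeasure_map measurable_fst.aemeasurable
  have : IsProbabilityMeasure (μ.map Prod.snd) :=
    Measure.isProbabilityMeasure_map measurable_snd.aemeasurable
  have hFX' : FX = fun x => (μ.map Prod.fst).real (Iic x) := by
    funext x
    rw [map_measureReal_apply measurable_fst measurableSet_Iic, hFX, prod_univ, measureReal_def]
  have hFY' : FY = fun y => (μ.map Prod.snd).real (Iic y) := by
    funext y
    rw [map_measureReal_apply measurable_snd measurableSet_Iic, hFY, univ_prod, measureReal_def]
  have : NullSingletonClass (μ.map Prod.fst) := nullSingletonClass_of_continuous_real_Iic _ (hFX' ▸ hFXcont)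
  have : NullSingletonClass (μ.map Prod.snd) := nullSingletonClass_of_continuous_real_Iic _ (hFY' ▸ hFYcont)
  have hX : (μ.map Prod.fst).map (fun x => 2 * 1 - x) = μ.map Prod.fst := by
    conv_rhs => rw [← hsym]
    rw [Measure.map_map (by fun_prop) (by fun_prop), Measure.map_map (by fun_prop) (by fun_prop)]
    congr 1; ext p; simp
  have hY : (μ.map Prod.snd).map (fun y => 2 * 1 - y) = μ.map Prod.snd := by
    conv_rhs => rw [← hsym]
    rw [Measure.map_map (by fun_prop) (by fun_prop), Measure.map_map (by fun_prop) (by fun_prop)]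
    congr 1; ext p; simp
  have hFXsym : ∀ x, FX (2 - x) = 1 - FX x := fun x => by
    simpa [hFX'] using real_Iic_reflect hX x
  have hFYsym : ∀ y, FY (2 - y) = 1 - FY y := fun y => by
    simpa [hFY'] using real_Iic_reflect hY y
  have hsum : ∀ x y, 0 ≤ x → 0 ≤ y → x + y = 1 → FX x + FY y = 1 / 2 := fun x y hx hy hxy => by
    rw [hFX', hFY', eq_sub_of_add_eq' hxy]
    exact real_Iic_fst_add_real_Iic_snd hX hY hae hx (by linarith)
  rintro ⟨x, y⟩ hp
  rw [hdτ]
  change |x - 1| + |y - 1| = 1 at hp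
  change F x y - (FX x + FY y) / 2 = _
  rcases le_total x 1 with hx | hx <;> rcases le_total y 1 with hy | hy
  · rw [abs_of_nonpos (by linarith), abs_of_nonpos (by linarith)] at hp
    have hzero : F x y = 0 := by
      have hline : ∀ᵐ q ∂μ, q.1 ≠ x := by
        refine ae_of_ae_map (p := fun t => t ≠ x) measurable_fst.aemeasurable ?_
        simp [ae_iff]
      have hnull : μ (Iic x ×ˢ Iic y) = 0 := by
        rw [measure_eq_zero_iff_ae_notMem]
        filter_upwards [hae, hline] with q hq hqx hmem
        obtain ⟨h1, h2⟩ : q.1 ≤ x ∧ q.2 ≤ y := hmem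
        rw [abs_of_nonpos (by linarith), abs_of_nonpos (by linarith)] at hq
        exact hqx (by linarith)
      rw [hF, hnull, ENNReal.toReal_zero]
    linarith [hsum x y (by linarith) (by linarith) (by linarith)]
  · rw [abs_of_nonpos (by linarith), abs_of_nonneg (by linarith)] at hp
    have hFeq : F x y = FX x := by
      rw [hF, hFX]
      congr 1
      apply measure_congr
      filter_upwards [hae] with q hq
      refine propext (and_congr_right fun h1 => iff_of_true ?_ trivial)
      have h1 : q.1 ≤ x := h1
      rw [abs_of_nonpos (by linarith)] at hq
      exact show q.2 ≤ y by linarith [le_abs_self (q.2 - 1)]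
    linarith [hsum x (2 - y) (by linarith) (by linarith) (by linarith), hFYsym y]
  · rw [abs_of_nonneg (by linarith), abs_of_nonpos (by linarith)] at hp
    have hFeq : F x y = FY y := by
      rw [hF, hFY]
      congr 1
      apply measure_congr
      filter_upwards [hae] with q hq
      refine propext (and_congr_left fun h2 => iff_of_true ?_ trivial)
      have h2 : q.2 ≤ y := h2
      rw [abs_of_nonpos (a := q.2 - 1) (by linarith)] at hq
      exact show q.1 ≤ x by linarith [le_abs_self (q.1 - 1)]
    linarith [hsum (2 - x) y (by linarith) (by linarith) (by linarith), hFXsym x]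
  · rw [abs_of_nonneg (by linarith), abs_of_nonneg (by linarith)] at hp
    have hFeq : F x y = FX x + FY y - 1 := by
      have hunion : μ.real (Iic x ×ˢ univ ∪ univ ×ˢ Iic y) = 1 := by
        rw [measureReal_def, (prob_compl_eq_zero_iff
          ((measurableSet_Iic.prod .univ).union (MeasurableSet.univ.prod measurableSet_Iic))).1,
          ENNReal.toReal_one]
        rw [measure_eq_zero_iff_ae_notMem]
        filter_upwards [hae] with q hq hmem
        simp only [mem_compl_iff, mem_union, mem_prod, mem_Iic, mem_univ, and_true, true_and,
          not_or, not_le] at hmem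
        linarith [le_abs_self (q.1 - 1), le_abs_self (q.2 - 1)]
      have hadd := measureReal_union_add_inter (μ := μ) (s := Iic x ×ˢ univ) (t := univ ×ˢ Iic y)
        (MeasurableSet.univ.prod measurableSet_Iic)
      rw [hunion, prod_inter_prod, inter_univ, univ_inter] at hadd
      rw [hF, hFX, hFY, ← measureReal_def, ← measureReal_def, ← measureReal_def]
      linarith
    linarith [hsum (2 - x) (2 - y) (by linarith) (by linarith) (by linarith), hFXsym x, hFYsym y]
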